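/- Let (H, H^{2,0}, H^{1,1}, H^{0,2}) be a rational Hodge structure of weight 2 with H^{2,0} ≠ 0, carrying an automorphism ψ with ψ^p = id for a positive integer p, such that the ℂ-linear extension ψ_ℂ acts on H^{2,0} as multiplication by a scalar λ with λ ≠ 1. Let (H₁, H₁^{1,0}, H₁^{0,1}) be a rational Hodge structure of weight 1 carrying an automorphism ψ' with (ψ')^p = id, such that λ^{-1} is not an eigenvalue of ψ'_ℂ on H₁^{1,0} but λ^{-1} is an eigenvalue of ψ'_ℂ on H₁^{0,1}. Let H₂ := {x ∈ H₁ ⊗_ℚ H : (ψ' ⊗ ψ)(x) = x}. Then: (i) H₂ ≠ 0; (ii) H₂ is a sub-Hodge structure of the weight 3 Hodge structure H₁ ⊗_ℚ H; (iii) (H₂)_ℂ ∩ (H₁^{1,0} ⊗ H^{2,0}) = 0; and (iv) (H₂)_ℂ ∩ (H₁^{0,1} ⊗ H^{0,2}) = 0. -/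

import Mathlib

/- STATEMENT 5: Given a weight 2 rational Hodge structure H with automorphism ψ of
order dividing p acting on H^{2,0} by a scalar λ ≠ 1, and a weight 1 rational Hodge
structure H₁ with automorphism ψ' of order dividing p such that λ⁻¹ is not an
eigenvalue of ψ' on H₁^{1,0} but is an eigenvalue on H₁^{0,1}, the fixed subspace
H₂ = (H₁ ⊗ H)^{ψ'⊗ψ} is a nonzero sub-Hodge structure of the weight 3 Hodge structure
H₁ ⊗ H whose (3,0)- and (0,3)-parts vanish. -/

open TensorProduct

/-- Complex conjugation on `ℂ ⊗[ℚ] H`, acting on the `ℂ` factor. -/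
noncomputable def conjC (H : Type*) [AddCommGroup H] [Module ℚ H] :
    ℂ ⊗[ℚ] H →ₗ[ℚ] ℂ ⊗[ℚ] H :=
  LinearMap.rTensor H ((Complex.conjAe.toLinearMap : ℂ →ₗ[ℝ] ℂ).restrictScalars ℚ)

/-- Given complex subspaces `P ⊆ ℂ ⊗ H₁` and `Q ⊆ ℂ ⊗ H`, the image of `P ⊗ Q` in
`ℂ ⊗ (H₁ ⊗ H)` under the canonical identification
`(ℂ ⊗ H₁) ⊗[ℂ] (ℂ ⊗ H) ≃ ℂ ⊗ (H₁ ⊗ H)`. -/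
noncomputable def hodgeComp {H₁ H : Type*} [AddCommGroup H₁] [Module ℚ H₁]
    [AddCommGroup H] [Module ℚ H]
    (P : Submodule ℂ (ℂ ⊗[ℚ] H₁)) (Q : Submodule ℂ (ℂ ⊗[ℚ] H)) :
    Submodule ℂ (ℂ ⊗[ℚ] (H₁ ⊗[ℚ] H)) :=
  Submodule.map
    ((TensorProduct.AlgebraTensorModule.distribBaseChange ℚ ℂ H₁ H).symm.toLinearMap)
    (LinearMap.range (TensorProduct.mapIncl P Q))

section Fixed

variable {K V W : Type*} [Field K] [AddCommGroup V] [Module K V] [AddCommGroup W] [Module K W]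

/-- An endomorphism preserving every summand of an internal direct sum commutes with the
projections onto the summands. -/
theorem DirectSum.IsInternal.exists_commuting_projections {ι : Type*} [Fintype ι] [DecidableEq ι]
    {A : ι → Submodule K V} (hA : DirectSum.IsInternal A) (f : V →ₗ[K] V)
    (hf : ∀ i, ∀ v ∈ A i, f v ∈ A i) :
    ∃ q : ι → V →ₗ[K] V, (∀ i v, q i v ∈ A i) ∧ ∑ i, q i = LinearMap.id ∧
      ∀ i, q i ∘ₗ f = f ∘ₗ q i := by
  let e := LinearEquiv.ofBijective (DirectSum.coeLinearMap A) hA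
  have he (j : ι) (a : A j) : e.symm (a : V) = DirectSum.lof K ι (fun i => A i) j a := by
    rw [LinearEquiv.symm_apply_eq]
    exact (DirectSum.coeLinearMap_lof A j a).symm
  let q : ι → V →ₗ[K] V := fun i =>
    (A i).subtype ∘ₗ DirectSum.component K ι (fun i => A i) i ∘ₗ e.symm.toLinearMap
  have hq_self (i : ι) (a : A i) : q i a = a := by
    simp [q, he, DirectSum.component.lof_self]
  have hq_ne (i j : ι) (hij : j ≠ i) (a : A j) : q i a = 0 := by
    simp [q, he, DirectSum.component.of, hij]
  have hext {g h : V →ₗ[K] V} (H : ∀ j, ∀ a : A j, g a = h a) : g = h := by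
    refine LinearMap.ext_on_range (v := fun x : Σ j, A j => (x.2 : V)) ?_ fun x => H x.1 x.2
    refine eq_top_iff.mpr (hA.submodule_iSup_eq_top.ge.trans (iSup_le fun j v hv => ?_))
    exact Submodule.subset_span ⟨⟨j, v, hv⟩, rfl⟩
  refine ⟨q, fun i v => Subtype.property _, hext fun j a => ?_, fun i => hext fun j a => ?_⟩
  · rw [LinearMap.sum_apply, Finset.sum_eq_single j (fun i _ hij => hq_ne i j hij.symm a)
      (by simp), hq_self, LinearMap.id_apply]
  · have hfa : f a = ((⟨f a, hf j a a.2⟩ : A j) : V) := rfl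
    change q i (f a) = f (q i a)
    rcases eq_or_ne j i with rfl | hij
    · rw [hq_self, hfa, hq_self]
    · rw [hq_ne i j hij a, hfa, hq_ne i j hij, map_zero]

/-- If `g` acts on `Q` by `c ≠ 0` and `c⁻¹` is not an eigenvalue of `f` on `P`, then `f ⊗ g` has no
nonzero fixed vector in `P ⊗ Q`. -/
theorem TensorProduct.eq_zero_of_map_eq_self_of_mem_range_mapIncl
    {P : Submodule K V} {Q : Submodule K W} {f : V →ₗ[K] V} {g : W →ₗ[K] W} {c : K} (hc : c ≠ 0)
    (hP : ∀ v ∈ P, f v ∈ P) (hf : ∀ v ∈ P, f v = c⁻¹ • v → v = 0) (hg : ∀ w ∈ Q, g w = c • w)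
    {x : V ⊗[K] W} (hx : x ∈ LinearMap.range (mapIncl P Q)) (hfix : map f g x = x) : x = 0 := by
  obtain ⟨y, rfl⟩ := hx
  let h : P →ₗ[K] P := c • f.restrict hP - LinearMap.id
  have hinj : Function.Injective h := by
    rw [← LinearMap.ker_eq_bot, LinearMap.ker_eq_bot']
    intro v hv
    have hv' : c • f v = v := by simpa [h, sub_eq_zero, Subtype.ext_iff] using hv
    exact Subtype.ext (hf v v.2 (by rw [eq_inv_smul_iff₀ hc, hv']))
  have hcomm : mapIncl P Q ∘ₗ h.rTensor Q = map f g ∘ₗ mapIncl P Q - mapIncl P Q := by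
    ext v w
    simp [h, mapIncl, hg w w.2]
  have hincl : Function.Injective (mapIncl P Q) :=
    map_injective_of_flat_flat _ _ P.injective_subtype Q.injective_subtype
  have hy : h.rTensor Q y = 0 := by
    apply hincl
    rw [map_zero, ← LinearMap.comp_apply, hcomm, LinearMap.sub_apply, LinearMap.comp_apply, hfix,
      sub_self]
  rw [(injective_iff_map_eq_zero _).mp
    (Module.Flat.rTensor_preserves_injective_linearMap (M := Q) h hinj) y hy, map_zero]

theorem TensorProduct.tmul_ne_zero_of_field {v : V} {w : W} (hv : v ≠ 0) (hw : w ≠ 0) :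
    v ⊗ₜ[K] w ≠ 0 := by
  intro h
  refine hv ((Module.forall_dual_apply_eq_zero_iff K v).mp fun φ => ?_)
  have hφ := congrArg (TensorProduct.lid K W ∘ φ.rTensor W) h
  simpa [hw] using hφ

end Fixed

section BaseChange

variable {H₁ H : Type*} [AddCommGroup H₁] [Module ℚ H₁] [AddCommGroup H] [Module ℚ H]

theorem conjC_smul (c : ℂ) (x : ℂ ⊗[ℚ] H) :
    conjC H (c • x) = (starRingEnd ℂ c) • conjC H x := by
  induction x with
  | zero => simp
  | tmul z h => simp [conjC, smul_tmul']
  | add x y hx hy => simp only [smul_add, map_add, hx, hy]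

theorem conjC_baseChange (f : H →ₗ[ℚ] H) (x : ℂ ⊗[ℚ] H) :
    conjC H (f.baseChange ℂ x) = f.baseChange ℂ (conjC H x) := by
  induction x with
  | zero => simp
  | tmul z h => simp [conjC]
  | add x y hx hy => simp only [map_add, hx, hy]

theorem conjC_conjC (x : ℂ ⊗[ℚ] H) : conjC H (conjC H x) = x := by
  induction x with
  | zero => simp
  | tmul z h => simp [conjC]
  | add x y hx hy => simp only [map_add, hx, hy]

theorem distribBaseChange_baseChange_map (f : H₁ →ₗ[ℚ] H₁) (g : H →ₗ[ℚ] H)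
    (x : ℂ ⊗[ℚ] (H₁ ⊗[ℚ] H)) :
    AlgebraTensorModule.distribBaseChange ℚ ℂ H₁ H ((map f g).baseChange ℂ x) =
      map (f.baseChange ℂ) (g.baseChange ℂ)
        (AlgebraTensorModule.distribBaseChange ℚ ℂ H₁ H x) := by
  suffices h : (AlgebraTensorModule.distribBaseChange ℚ ℂ H₁ H).toLinearMap ∘ₗ
      (map f g).baseChange ℂ = map (f.baseChange ℂ) (g.baseChange ℂ) ∘ₗ
        (AlgebraTensorModule.distribBaseChange ℚ ℂ H₁ H).toLinearMap from
    LinearMap.congr_fun h x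
  ext a b
  rfl

theorem mem_baseChange_ker_map_sub_id (f : H₁ →ₗ[ℚ] H₁) (g : H →ₗ[ℚ] H)
    (x : ℂ ⊗[ℚ] (H₁ ⊗[ℚ] H)) :
    x ∈ (LinearMap.ker (map f g - LinearMap.id)).baseChange ℂ ↔
      map (f.baseChange ℂ) (g.baseChange ℂ)
        (AlgebraTensorModule.distribBaseChange ℚ ℂ H₁ H x) =
        AlgebraTensorModule.distribBaseChange ℚ ℂ H₁ H x := by
  have hker : (LinearMap.ker (map f g - LinearMap.id)).baseChange ℂ =
      LinearMap.ker ((map f g - LinearMap.id).baseChange ℂ) :=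
    (Module.Flat.ker_lTensor_eq ℂ ℂ (map f g - LinearMap.id)).symm
  rw [hker, LinearMap.mem_ker, LinearMap.baseChange_sub, LinearMap.sub_apply,
    LinearMap.baseChange_id, LinearMap.id_apply, sub_eq_zero,
    ← distribBaseChange_baseChange_map, EmbeddingLike.apply_eq_iff_eq]

theorem mem_hodgeComp {P : Submodule ℂ (ℂ ⊗[ℚ] H₁)} {Q : Submodule ℂ (ℂ ⊗[ℚ] H)}
    {x : ℂ ⊗[ℚ] (H₁ ⊗[ℚ] H)} :
    x ∈ hodgeComp P Q ↔
      AlgebraTensorModule.distribBaseChange ℚ ℂ H₁ H x ∈ LinearMap.range (mapIncl P Q) :=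
  Submodule.mem_map_equiv _ (e := (AlgebraTensorModule.distribBaseChange ℚ ℂ H₁ H).symm)

theorem baseChange_ker_inf_hodgeComp_eq_bot {P : Submodule ℂ (ℂ ⊗[ℚ] H₁)}
    {Q : Submodule ℂ (ℂ ⊗[ℚ] H)} {f : H₁ →ₗ[ℚ] H₁} {g : H →ₗ[ℚ] H} {c : ℂ} (hc : c ≠ 0)
    (hP : ∀ v ∈ P, f.baseChange ℂ v ∈ P) (hf : ∀ v ∈ P, f.baseChange ℂ v = c⁻¹ • v → v = 0)
    (hg : ∀ w ∈ Q, g.baseChange ℂ w = c • w) :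
    (LinearMap.ker (map f g - LinearMap.id)).baseChange ℂ ⊓ hodgeComp P Q = ⊥ := by
  refine (Submodule.eq_bot_iff _).mpr fun x hx => ?_
  rw [Submodule.mem_inf, mem_baseChange_ker_map_sub_id, mem_hodgeComp] at hx
  simpa using eq_zero_of_map_eq_self_of_mem_range_mapIncl hc hP hf hg hx.2 hx.1

/-- The fixed part of `f ⊗ g` is spanned by its intersections with the components `A i ⊗ B j`
whenever `f` and `g` preserve the decompositions `A` and `B`. -/
theorem baseChange_ker_le_iSup_inf_hodgeComp {ι κ : Type*} [Fintype ι] [DecidableEq ι] [Fintype κ]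
    [DecidableEq κ] {A : ι → Submodule ℂ (ℂ ⊗[ℚ] H₁)} {B : κ → Submodule ℂ (ℂ ⊗[ℚ] H)}
    (hA : DirectSum.IsInternal A) (hB : DirectSum.IsInternal B)
    (f : H₁ →ₗ[ℚ] H₁) (g : H →ₗ[ℚ] H)
    (hf : ∀ i, ∀ v ∈ A i, f.baseChange ℂ v ∈ A i) (hg : ∀ j, ∀ v ∈ B j, g.baseChange ℂ v ∈ B j) :
    (LinearMap.ker (map f g - LinearMap.id)).baseChange ℂ ≤
      ⨆ i, ⨆ j, (LinearMap.ker (map f g - LinearMap.id)).baseChange ℂ ⊓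
        hodgeComp (A i) (B j) := by
  intro x hx
  obtain ⟨q, hqA, hq_sum, hqf⟩ := hA.exists_commuting_projections _ hf
  obtain ⟨r, hrB, hr_sum, hrg⟩ := hB.exists_commuting_projections _ hg
  let D := AlgebraTensorModule.distribBaseChange ℚ ℂ H₁ H
  have hsum : x = ∑ i, ∑ j, D.symm (map (q i) (r j) (D x)) := by
    have h : ∑ i, ∑ j, map (q i) (r j) = LinearMap.id := by
      rw [← map_id, ← hq_sum, ← hr_sum]
      simp only [← mapBilinear_apply (R := ℂ), map_sum, LinearMap.sum_apply]
      rw [Finset.sum_comm]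
    apply D.injective
    simpa [map_sum] using (LinearMap.congr_fun h (D x)).symm
  rw [hsum]
  refine Submodule.sum_mem _ fun i _ => Submodule.sum_mem _ fun j _ => ?_
  refine Submodule.mem_iSup_of_mem i (Submodule.mem_iSup_of_mem j ⟨?_, ?_⟩)
  · refine (mem_baseChange_ker_map_sub_id f g _).mpr ?_
    rw [LinearEquiv.apply_symm_apply, ← LinearMap.comp_apply, ← map_comp, ← hqf, ← hrg, map_comp,
      LinearMap.comp_apply, (mem_baseChange_ker_map_sub_id f g x).mp hx]
  · refine mem_hodgeComp.mpr ?_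
    rw [LinearEquiv.apply_symm_apply]
    refine ⟨map ((q i).codRestrict _ (hqA i)) ((r j).codRestrict _ (hrB j)) (D x), ?_⟩
    rw [mapIncl, ← LinearMap.comp_apply, ← map_comp]
    rfl

end BaseChange

theorem statement5
    -- H is a finite-dimensional ℚ-vector space with a weight 2 Hodge structure
    (H : Type*) [AddCommGroup H] [Module ℚ H] [FiniteDimensional ℚ H]
    (H20 H11 H02 : Submodule ℂ (ℂ ⊗[ℚ] H))
    (hdec : DirectSum.IsInternal (![H20, H11, H02] : Fin 3 → Submodule ℂ (ℂ ⊗[ℚ] H)))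
    (hconj20 : (H20.restrictScalars ℚ).map (conjC H) = H02.restrictScalars ℚ)
    (hconj11 : (H11.restrictScalars ℚ).map (conjC H) = H11.restrictScalars ℚ)
    -- H^{2,0} ≠ 0
    (h20ne : H20 ≠ ⊥)
    -- ψ is an automorphism of the Hodge structure H with ψ^p = id, p > 0
    (p : ℕ) (hp : 0 < p)
    (ψ : Module.End ℚ H) (hψp : ψ ^ p = 1)
    (hψ11 : ∀ v ∈ H11, ψ.baseChange ℂ v ∈ H11)
    (hψ02 : ∀ v ∈ H02, ψ.baseChange ℂ v ∈ H02)
    -- ψ_ℂ acts on H^{2,0} as multiplication by λ, with λ ≠ 1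
    (lam : ℂ) (hlam : lam ≠ 1)
    (hψ20 : ∀ v ∈ H20, ψ.baseChange ℂ v = lam • v)
    -- H₁ is a finite-dimensional ℚ-vector space with a weight 1 Hodge structure
    (H₁ : Type*) [AddCommGroup H₁] [Module ℚ H₁] [FiniteDimensional ℚ H₁]
    (H10 H01 : Submodule ℂ (ℂ ⊗[ℚ] H₁))
    (hdec1 : IsCompl H10 H01)
    (hconj1 : (H10.restrictScalars ℚ).map (conjC H₁) = H01.restrictScalars ℚ)
    -- ψ' is an automorphism of the Hodge structure H₁ with ψ'^p = id
    (ψ' : Module.End ℚ H₁) (hψ'p : ψ' ^ p = 1)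
    (hψ'10 : ∀ v ∈ H10, ψ'.baseChange ℂ v ∈ H10)
    (hψ'01 : ∀ v ∈ H01, ψ'.baseChange ℂ v ∈ H01)
    -- λ⁻¹ is not an eigenvalue of ψ'_ℂ on H₁^{1,0}
    (hno : ∀ v ∈ H10, ψ'.baseChange ℂ v = lam⁻¹ • v → v = 0)
    -- λ⁻¹ is an eigenvalue of ψ'_ℂ on H₁^{0,1}
    (hyes : ∃ v ∈ H01, v ≠ 0 ∧ ψ'.baseChange ℂ v = lam⁻¹ • v) :
    -- H₂ := the fixed subspace of ψ' ⊗ ψ on H₁ ⊗ H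
    ∀ H₂ : Submodule ℚ (H₁ ⊗[ℚ] H),
      H₂ = LinearMap.ker (TensorProduct.map (ψ' : H₁ →ₗ[ℚ] H₁) (ψ : H →ₗ[ℚ] H)
        - LinearMap.id) →
    -- (i) H₂ ≠ 0
    H₂ ≠ ⊥ ∧
    -- (ii) H₂ is a sub-Hodge structure of the weight 3 Hodge structure H₁ ⊗ H
    H₂.baseChange ℂ =
        (H₂.baseChange ℂ ⊓ hodgeComp H10 H20)
      ⊔ (H₂.baseChange ℂ ⊓ (hodgeComp H10 H11 ⊔ hodgeComp H01 H20))
      ⊔ (H₂.baseChange ℂ ⊓ (hodgeComp H10 H02 ⊔ hodgeComp H01 H11))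
      ⊔ (H₂.baseChange ℂ ⊓ hodgeComp H01 H02) ∧
    -- (iii) (H₂)_ℂ ∩ (H₁^{1,0} ⊗ H^{2,0}) = 0
    H₂.baseChange ℂ ⊓ hodgeComp H10 H20 = ⊥ ∧
    -- (iv) (H₂)_ℂ ∩ (H₁^{0,1} ⊗ H^{0,2}) = 0
    H₂.baseChange ℂ ⊓ hodgeComp H01 H02 = ⊥ := by
  rintro H₂ rfl
  obtain ⟨w, hw, hw0⟩ := Submodule.exists_mem_ne_zero_of_ne_bot h20ne
  obtain ⟨u, hu, hu0, hψu⟩ := hyes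
  have hlam0 : lam ≠ 0 := by
    rintro rfl
    have h1 : (ψ.baseChange ℂ ^ p) w = w := by
      rw [← LinearMap.baseChange_pow, hψp, LinearMap.baseChange_one, Module.End.one_apply]
    obtain ⟨k, rfl⟩ := Nat.exists_eq_succ_of_ne_zero hp.ne'
    rw [pow_succ, Module.End.mul_apply, hψ20 w hw, zero_smul, map_zero] at h1
    exact hw0 h1.symm
  refine ⟨fun hbot => ?_, le_antisymm ?_ ?_, ?_, ?_⟩
  · let D := AlgebraTensorModule.distribBaseChange ℚ ℂ H₁ H
    have hmem : D.symm (u ⊗ₜ w) ∈ (LinearMap.ker (map ψ' ψ - LinearMap.id)).baseChange ℂ := by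
      rw [mem_baseChange_ker_map_sub_id, LinearEquiv.apply_symm_apply, map_tmul, hψu, hψ20 w hw,
        smul_tmul_smul, inv_mul_cancel₀ hlam0, one_smul]
    rw [hbot, Submodule.baseChange_bot, Submodule.mem_bot, LinearEquiv.map_eq_zero_iff] at hmem
    exact tmul_ne_zero_of_field hu0 hw0 hmem
  · have hdec1' : DirectSum.IsInternal (![H10, H01] : Fin 2 → Submodule ℂ (ℂ ⊗[ℚ] H₁)) :=
      (DirectSum.isInternal_submodule_iff_isCompl _ (i := 0) (j := 1) (by decide)
        (by ext i; fin_cases i <;> simp)).mpr hdec1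
    have hψ20' : ∀ v ∈ H20, ψ.baseChange ℂ v ∈ H20 := fun v hv => by
      rw [hψ20 v hv]
      exact H20.smul_mem _ hv
    refine (baseChange_ker_le_iSup_inf_hodgeComp hdec1' hdec ψ' ψ
      (Fin.forall_fin_two.mpr ⟨hψ'10, hψ'01⟩)
      (Fin.forall_fin_succ.mpr ⟨hψ20', Fin.forall_fin_two.mpr ⟨hψ11, hψ02⟩⟩)).trans ?_
    refine iSup_le (Fin.forall_fin_two.mpr ⟨?_, ?_⟩) <;>
      refine iSup_le (Fin.forall_fin_succ.mpr ⟨?_, Fin.forall_fin_two.mpr ⟨?_, ?_⟩⟩)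
    · exact le_sup_of_le_left (le_sup_of_le_left le_sup_left)
    · exact le_sup_of_le_left (le_sup_of_le_left
        (le_sup_of_le_right (inf_le_inf_left _ le_sup_left)))
    · exact le_sup_of_le_left (le_sup_of_le_right (inf_le_inf_left _ le_sup_left))
    · exact le_sup_of_le_left (le_sup_of_le_left
        (le_sup_of_le_right (inf_le_inf_left _ le_sup_right)))
    · exact le_sup_of_le_left (le_sup_of_le_right (inf_le_inf_left _ le_sup_right))
    · exact le_sup_right
  · exact sup_le (sup_le (sup_le inf_le_left inf_le_left) inf_le_left) inf_le_left
  · exact baseChange_ker_inf_hodgeComp_eq_bot hlam0 hψ'10 hno hψ20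
  · refine baseChange_ker_inf_hodgeComp_eq_bot (c := starRingEnd ℂ lam) (by simpa using hlam0) hψ'01
      (fun v hv hvc => ?_) fun w hw => ?_
    · obtain ⟨v, hv', rfl⟩ := hconj1.ge hv
      rw [hno v hv', map_zero]
      rw [← conjC_conjC (ψ'.baseChange ℂ v), conjC_baseChange, hvc, conjC_smul, conjC_conjC,
        map_inv₀, Complex.conj_conj]
    · obtain ⟨w, hw', rfl⟩ := hconj20.ge hw
      rw [← conjC_baseChange, hψ20 w hw', conjC_smul]
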